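/- Let R be a commutative Noetherian ring, I an ideal, and let C : F_2 →^ψ F_1 →^φ F_0 be a complex of R-modules with F_0, F_1, F_2 finitely generated and flat. Let U and W be submodules of a finitely generated R-module V. If H_1(C ⊗ (U + I^n V)/I^n W) has finite length for all sufficiently large n, then there exists a polynomial p with rational coefficients such that λ(H_1(C ⊗ (U + I^n V)/I^n W)) = p(n) for all sufficiently large n. -/

import Mathlib

set_option synthInstance.maxHeartbeats 1000000

/-- The length `λ(M)` of a module `M`, realized as the Krull dimension of the lattice of
submodules of `M`. -/
noncomputable def moduleLength (R M : Type*) [Ring R] [AddCommGroup M] [Module R M] :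
    WithBot ℕ∞ :=
  Order.krullDim (Submodule R M)

/-- For a complex `C : F₂ →ψ F₁ →φ F₀` of `R`-modules and an `R`-module `L`, the homology
`H₁(C ⊗ L) := ker (φ ⊗ id_L) / im (ψ ⊗ id_L)` at the middle spot of `F₂ ⊗ L → F₁ ⊗ L → F₀ ⊗ L`. -/
abbrev homologyOne {R F₀ F₁ F₂ : Type*} [CommRing R]
    [AddCommGroup F₀] [Module R F₀] [AddCommGroup F₁] [Module R F₁]
    [AddCommGroup F₂] [Module R F₂]
    (ψ : F₂ →ₗ[R] F₁) (φ : F₁ →ₗ[R] F₀) (L : Type*) [AddCommGroup L] [Module R L] :=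
  ↥(LinearMap.ker (φ.rTensor L)) ⧸
    (Submodule.comap (LinearMap.ker (φ.rTensor L)).subtype (LinearMap.range (ψ.rTensor L)))

open Submodule Polynomial

section RelLength

variable {R V V' : Type*} [CommRing R] [AddCommGroup V] [Module R V] [AddCommGroup V'] [Module R V']

/-- The length of `N / (N ∩ P)` for submodules `P` and `N` of a common module. -/
noncomputable def relLength (P N : Submodule R V) : ℕ∞ :=
  Module.length R (N ⧸ P.comap N.subtype)

lemma relLength_inf_left (P N : Submodule R V) : relLength (P ⊓ N) N = relLength P N := by
  unfold relLength
  rw [comap_inf, comap_subtype_self, inf_top_eq]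

lemma relLength_self (N : Submodule R V) : relLength N N = 0 := by
  unfold relLength
  rw [comap_subtype_self, Module.length_eq_zero_iff]
  exact Submodule.Quotient.subsingleton_iff.2 rfl

lemma relLength_comap (f : V →ₗ[R] V') (P : Submodule R V') (N : Submodule R V) :
    relLength (P.comap f) N = relLength P (N.map f) := by
  let g : N →ₗ[R] N.map f := f.submoduleMap N
  have hg : Function.Surjective g := f.submoduleMap_surjective N
  let h := (P.comap (N.map f).subtype).mkQ ∘ₗ g
  have hh : Function.Surjective h := (mkQ_surjective _).comp hg
  have hker : LinearMap.ker h = (P.comap f).comap N.subtype := by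
    simp only [h, LinearMap.ker_comp, ker_mkQ]
    rfl
  unfold relLength
  rw [← hker]
  exact (h.quotKerEquivOfSurjective hh).length_eq

lemma relLength_sup_right (P N : Submodule R V) : relLength P (N ⊔ P) = relLength P N := by
  have h1 := relLength_comap P.mkQ ⊥ N
  have h2 := relLength_comap P.mkQ ⊥ (N ⊔ P)
  rw [comap_bot, ker_mkQ] at h1 h2
  rw [h1, h2, Submodule.map_sup, mkQ_map_self, sup_bot_eq]

lemma relLength_add {P N Q : Submodule R V} (hPN : P ≤ N) (hNQ : N ≤ Q) :
    relLength P Q = relLength P N + relLength N Q := by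
  unfold relLength
  let f : (N ⧸ P.comap N.subtype) →ₗ[R] (Q ⧸ P.comap Q.subtype) :=
    mapQ _ _ (inclusion hNQ) (show P.comap N.subtype ≤ (P.comap Q.subtype).comap (inclusion hNQ) from fun _ hx ↦ hx)
  let g : (Q ⧸ P.comap Q.subtype) →ₗ[R] (Q ⧸ N.comap Q.subtype) :=
    mapQ _ _ LinearMap.id (fun _ hx ↦ hPN hx)
  refine Module.length_eq_add_of_exact f g ?_ ?_ ?_
  · rw [← LinearMap.ker_eq_bot, eq_bot_iff]
    intro x hx
    induction x using Submodule.Quotient.induction_on with | _ x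
    have hx' : inclusion hNQ x ∈ P.comap Q.subtype := (Submodule.Quotient.mk_eq_zero _).1 hx
    exact (Submodule.Quotient.mk_eq_zero _).2 hx'
  · intro x
    induction x using Submodule.Quotient.induction_on with | _ x
    exact ⟨Submodule.Quotient.mk x, rfl⟩
  · intro x
    induction x using Submodule.Quotient.induction_on with | _ x
    simp only [g, mapQ_apply, LinearMap.id_apply, Submodule.Quotient.mk_eq_zero]
    constructor
    · intro hx
      exact ⟨Submodule.Quotient.mk ⟨x.1, hx⟩, rfl⟩
    · rintro ⟨y, hy⟩
      induction y using Submodule.Quotient.induction_on with | _ y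
      have hy' : inclusion hNQ y - x ∈ P.comap Q.subtype := (Submodule.Quotient.eq _).1 hy
      have h : (x : V) = y - ((inclusion hNQ y - x : Q) : V) := by simp
      change (x : V) ∈ N
      rw [h]
      exact N.sub_mem y.2 (hPN hy')

end RelLength

/-- `f` agrees with a rational polynomial at all large arguments; in particular it is eventually
finite. -/
def EventuallyPolynomial (f : ℕ → ℕ∞) : Prop :=
  ∃ (p : ℚ[X]) (N₀ : ℕ), ∀ n ≥ N₀, ∃ ℓ : ℕ, f n = ℓ ∧ (ℓ : ℚ) = p.eval (n : ℚ)

lemma exists_polynomial_eval_add_one_sub (p : ℚ[X]) :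
    ∃ q : ℚ[X], ∀ x : ℚ, q.eval (x + 1) - q.eval x = p.eval x := by
  induction p using Polynomial.induction_on' with
  | add p₁ p₂ h₁ h₂ =>
    obtain ⟨q₁, h₁⟩ := h₁
    obtain ⟨q₂, h₂⟩ := h₂
    exact ⟨q₁ + q₂, fun x ↦ by rw [eval_add, eval_add, eval_add, ← h₁, ← h₂]; ring⟩
  | monomial n a =>
    refine ⟨C (a / ((n : ℚ) + 1)) * Polynomial.bernoulli (n + 1), fun x ↦ ?_⟩
    have h := Polynomial.bernoulli_eval_one_add (n + 1) x
    have hn : (n : ℚ) + 1 ≠ 0 := by positivity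
    rw [add_comm x 1, eval_mul, eval_mul, h, eval_C, eval_C, eval_monomial]
    simp only [Nat.add_sub_cancel, Nat.cast_add, Nat.cast_one]
    field_simp
    ring

namespace EventuallyPolynomial

lemma zero_of_ge {f : ℕ → ℕ∞} {N₀ : ℕ} (h : ∀ n ≥ N₀, f n = 0) : EventuallyPolynomial f :=
  ⟨0, N₀, fun n hn ↦ ⟨0, by simp [h n hn]⟩⟩

lemma add {f g : ℕ → ℕ∞} (hf : EventuallyPolynomial f) (hg : EventuallyPolynomial g) :
    EventuallyPolynomial (fun n ↦ f n + g n) := by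
  obtain ⟨p, N, hp⟩ := hf
  obtain ⟨q, M, hq⟩ := hg
  refine ⟨p + q, max N M, fun n hn ↦ ?_⟩
  obtain ⟨a, ha, ha'⟩ := hp n (le_trans (le_max_left _ _) hn)
  obtain ⟨b, hb, hb'⟩ := hq n (le_trans (le_max_right _ _) hn)
  exact ⟨a + b, by simp [ha, hb], by simp [ha', hb']⟩

lemma of_eq_sub {f g : ℕ → ℕ∞} (hf : EventuallyPolynomial f) (k : ℕ)
    (h : ∀ n ≥ k, g n = f (n - k)) : EventuallyPolynomial g := by
  obtain ⟨p, N, hp⟩ := hf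
  refine ⟨p.comp (X - C (k : ℚ)), N + k, fun n hn ↦ ?_⟩
  obtain ⟨a, ha, ha'⟩ := hp (n - k) (by lia)
  refine ⟨a, by rw [h n (by lia), ha], ?_⟩
  rw [ha', Nat.cast_sub (by lia)]
  simp

lemma comp_add_one {f : ℕ → ℕ∞} (hf : EventuallyPolynomial f) :
    EventuallyPolynomial (fun n ↦ f (n + 1)) := by
  obtain ⟨p, N, hp⟩ := hf
  refine ⟨p.comp (X + 1), N, fun n hn ↦ ?_⟩
  obtain ⟨a, ha, ha'⟩ := hp (n + 1) (by lia)
  exact ⟨a, ha, by simp [ha']⟩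

lemma of_add_eq_add {f k c : ℕ → ℕ∞} (hk : EventuallyPolynomial k) (hc : EventuallyPolynomial c)
    {N₀ : ℕ} (hf : ∀ n ≥ N₀, f n ≠ ⊤) (h : ∀ n ≥ N₀, f (n + 1) + k n = f n + c n) :
    EventuallyPolynomial f := by
  obtain ⟨p, N, hp⟩ := hk
  obtain ⟨q, M, hq⟩ := hc
  obtain ⟨r, hr⟩ := exists_polynomial_eval_add_one_sub (q - p)
  set L := max N₀ (max N M)
  have key : ∀ n ≥ L, ((f n).toNat : ℚ) = ((f L).toNat : ℚ) - r.eval (L : ℚ) + r.eval (n : ℚ) := by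
    intro n hn
    induction n, hn using Nat.le_induction with
    | base => ring
    | succ n hn ih =>
      obtain ⟨a, ha, ha'⟩ := hp n (by lia)
      obtain ⟨b, hb, hb'⟩ := hq n (by lia)
      have h1 := h n (by lia)
      have h2 := hr n
      lift f n to ℕ using hf n (by lia) with x hx
      lift f (n + 1) to ℕ using hf (n + 1) (by lia) with y hy
      rw [ha, hb] at h1
      have h3 : (y : ℚ) + a = x + b := by exact_mod_cast h1
      simp only [ENat.toNat_natCast, eval_sub, Nat.cast_add, Nat.cast_one] at *
      linarith
  refine ⟨C (((f L).toNat : ℚ) - r.eval (L : ℚ)) + r, L, fun n hn ↦ ⟨(f n).toNat, ?_, ?_⟩⟩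
  · exact (ENat.natCast_toNat (hf n (by lia))).symm
  · rw [key n hn]; simp

end EventuallyPolynomial

section Hilbert

variable {R V : Type*} [CommRing R] [AddCommGroup V] [Module R V]

/-- A sequence of submodules is stable under `s` if elements of `s`, acting in degree one, map
each term to the next one. -/
def GradedStable (s : Set R) (Q : ℕ → Submodule R V) : Prop :=
  ∀ x ∈ s, ∀ n, ∀ v ∈ Q n, x • v ∈ Q (n + 1)

/-- The ascending chain condition for `s`-stable sequences of submodules between `P` and `N`. -/
def GradedNoetherian (s : Set R) (P N : ℕ → Submodule R V) : Prop :=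
  ∀ c : ℕ →o (ℕ → Submodule R V), (∀ i, P ≤ c i ∧ c i ≤ N ∧ GradedStable s (c i)) →
    ∃ k, ∀ j ≥ k, c j = c k

lemma GradedNoetherian.mono {s t : Set R} {P N P' N' : ℕ → Submodule R V}
    (h : GradedNoetherian s P N) (hP : P ≤ P') (hN : N' ≤ N)
    (hst : ∀ Q, P' ≤ Q → Q ≤ N' → GradedStable t Q → GradedStable s Q) :
    GradedNoetherian t P' N' := fun c hc ↦
  h c fun i ↦ ⟨hP.trans (hc i).1, (hc i).2.1.trans hN, hst _ (hc i).1 (hc i).2.1 (hc i).2.2⟩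

theorem eventuallyPolynomial_relLength_of_gradedNoetherian (s : Finset R)
    (P N : ℕ → Submodule R V) (hPN : P ≤ N) (hP : GradedStable (s : Set R) P)
    (hN : GradedStable (s : Set R) N) (hacc : GradedNoetherian (s : Set R) P N)
    (hfin : ∃ N₀, ∀ n ≥ N₀, relLength (P n) (N n) ≠ ⊤) :
    EventuallyPolynomial fun n ↦ relLength (P n) (N n) := by
  classical
  induction s using Finset.induction_on generalizing P N with
  | empty =>
    let c : ℕ →o (ℕ → Submodule R V) :=
      ⟨fun k n ↦ if n < k then N n else P n, fun i j hij n ↦ by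
        dsimp only
        split_ifs
        · exact le_rfl
        · lia
        · exact hPN n
        · exact le_rfl⟩
    obtain ⟨k, hk⟩ := hacc c fun i ↦ by
      refine ⟨fun n ↦ ?_, fun n ↦ ?_, fun x hx ↦ by simp at hx⟩
      · change P n ≤ if n < i then N n else P n
        split_ifs
        exacts [hPN n, le_rfl]
      · change (if n < i then N n else P n) ≤ N n
        split_ifs
        exacts [le_rfl, hPN n]
    refine .zero_of_ge (N₀ := k) fun n hn ↦ ?_
    have h := congrFun (hk (n + 1) (by lia)) n
    change (if n < n + 1 then N n else P n) = if n < k then N n else P n at h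
    rw [if_pos (by lia), if_neg (by lia)] at h
    rw [h, relLength_self]
  | insert a s _ ih =>
    let K : ℕ → Submodule R V := fun n ↦ N n ⊓ (P (n + 1)).comap (LinearMap.lsmul R V a)
    let C : ℕ → Submodule R V
      | 0 => P 0
      | n + 1 => P (n + 1) ⊔ (N n).map (LinearMap.lsmul R V a)
    have ha : a ∈ ((insert a s : Finset R) : Set R) := by simp
    have hs : ∀ x ∈ (s : Set R), x ∈ ((insert a s : Finset R) : Set R) := fun x hx ↦ by
      rw [Finset.coe_insert]; exact Set.mem_insert_of_mem _ hx
    have hPK : P ≤ K := fun n ↦ le_inf (hPN n) fun v hv ↦ hP a ha n v hv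
    have hKN : K ≤ N := fun n ↦ inf_le_left
    have hPC : P ≤ C := fun n ↦ by
      cases n
      exacts [le_rfl, le_sup_left]
    have hCN : C ≤ N := fun n ↦ by
      cases n with
      | zero => exact hPN 0
      | succ n => exact sup_le (hPN _) (map_le_iff_le_comap.2 fun v hv ↦ hN a ha n v hv)
    have hPs : GradedStable (s : Set R) P := fun x hx ↦ hP x (hs x hx)
    have hNs : GradedStable (s : Set R) N := fun x hx ↦ hN x (hs x hx)
    have hKs : GradedStable (s : Set R) K := fun x hx n v hv ↦ by
      refine ⟨hNs x hx n v hv.1, ?_⟩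
      have := hPs x hx _ _ hv.2
      change a • x • v ∈ P (n + 2)
      rw [smul_comm]
      exact this
    have hCs : GradedStable (s : Set R) C := fun x hx n v hv ↦ by
      cases n with
      | zero => exact le_sup_left (a := P 1) (hPs x hx 0 v hv)
      | succ n =>
        obtain ⟨p, hp, _, ⟨w, hw, rfl⟩, rfl⟩ := mem_sup.1 hv
        rw [smul_add]
        refine add_mem (le_sup_left (a := P (n + 2)) (hPs x hx _ p hp))
          (le_sup_right (a := P (n + 2)) ⟨x • w, hNs x hx _ w hw, ?_⟩)
        simp only [LinearMap.lsmul_apply]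
        rw [smul_comm]
    have hKacc : GradedNoetherian (s : Set R) P K :=
      hacc.mono le_rfl hKN fun Q hPQ hQK hQ x hx n v hv ↦ by
        rw [Finset.coe_insert] at hx
        obtain rfl | hx := hx
        · exact hPQ _ (hQK n hv).2
        · exact hQ x hx n v hv
    have hCacc : GradedNoetherian (s : Set R) C N :=
      hacc.mono hPC le_rfl fun Q hCQ hQN hQ x hx n v hv ↦ by
        rw [Finset.coe_insert] at hx
        obtain rfl | hx := hx
        · exact hCQ (n + 1) (le_sup_right (a := P (n + 1)) ⟨v, hQN n hv, rfl⟩)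
        · exact hQ x hx n v hv
    obtain ⟨N₀, hN₀⟩ := hfin
    have hKfin : ∀ n ≥ N₀, relLength (P n) (K n) ≠ ⊤ := fun n hn h ↦
      hN₀ n hn (by rw [relLength_add (hPK n) (hKN n), h, top_add])
    have hCfin : ∀ n ≥ N₀, relLength (C n) (N n) ≠ ⊤ := fun n hn h ↦
      hN₀ n hn (by rw [relLength_add (hPC n) (hCN n), h, add_top])
    refine .of_add_eq_add (ih P K hPK hPs hKs hKacc ⟨N₀, hKfin⟩)
      (ih C N hCN hCs hNs hCacc ⟨N₀, hCfin⟩).comp_add_one hN₀ fun n _ ↦ ?_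
    have h1 : relLength (K n) (N n) = relLength (P (n + 1)) (C (n + 1)) := by
      simp only [K, C]
      rw [inf_comm, relLength_inf_left, relLength_comap, sup_comm, relLength_sup_right]
    rw [relLength_add (hPC (n + 1)) (hCN (n + 1)), relLength_add (hPK n) (hKN n), h1]
    ring

end Hilbert

section Rees

variable {R V : Type*} [CommRing R] [IsNoetherianRing R] [AddCommGroup V] [Module R V]
  [Module.Finite R V] (I : Ideal R)

lemma GradedStable.pow_smul_le {R V : Type*} [CommRing R] [AddCommGroup V] [Module R V]
    {I : Ideal R} {s : Set R} (hs : Ideal.span s = I) {Q : ℕ → Submodule R V}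
    (hQ : GradedStable s Q) (i j : ℕ) : I ^ i • Q j ≤ Q (i + j) := by
  induction i with
  | zero => simp
  | succ i ih =>
    rw [pow_succ', mul_smul]
    refine (smul_mono_right I ih).trans ?_
    rw [show i + 1 + j = i + j + 1 by ring, smul_le, ← hs]
    intro x hx v hv
    induction hx using span_induction with
    | mem x hx => exact hQ x hx _ v hv
    | zero => rw [zero_smul]; exact zero_mem _
    | add x y _ _ hx hy => rw [add_smul]; exact add_mem hx hy
    | smul r x _ hx => rw [smul_assoc]; exact smul_mem _ r hx

lemma gradedStable_pow_smul {R V : Type*} [CommRing R] [AddCommGroup V] [Module R V]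
    {I : Ideal R} {s : Set R} (hs : Ideal.span s = I) (G : Submodule R V) :
    GradedStable s fun n ↦ I ^ n • G := fun x hx n v hv ↦ by
  dsimp only
  rw [pow_succ', mul_smul]
  exact smul_mem_smul (hs ▸ subset_span hx) hv

lemma gradedNoetherian_pow_smul {s : Set R} (hs : Ideal.span s = I) (G : Submodule R V) :
    GradedNoetherian s ⊥ fun n ↦ I ^ n • G := by
  intro c hc
  let S (i : ℕ) : Submodule (reesAlgebra I) (PolynomialModule R V) :=
    { carrier := { f | ∀ n, f.coeff n ∈ c i n }
      add_mem' := fun hf hg n ↦ Submodule.add_mem _ (hf n) (hg n)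
      zero_mem' := fun _ ↦ Submodule.zero_mem _
      smul_mem' := fun r f hf n ↦ by
        rw [Subalgebra.smul_def, PolynomialModule.smul_apply]
        apply Submodule.sum_mem
        rintro ⟨j, k⟩ e
        rw [Finset.HasAntidiagonal.mem_antidiagonal] at e
        subst e
        exact (hc i).2.2.pow_smul_le hs j k (Submodule.smul_mem_smul (r.2 j) (hf k)) }
  have hfg : (I.stableFiltration G).submodule.FG :=
    ((I.stableFiltration G).submodule_fg_iff_stable fun _ ↦ IsNoetherian.noetherian _).2
      (I.stableFiltration_stable G)
  have hnoeth := isNoetherian_of_fg_of_noetherian _ hfg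
  have hle (i : ℕ) : S i ≤ (I.stableFiltration G).submodule := fun f hf n ↦ (hc i).2.1 n (hf n)
  obtain ⟨k, hk⟩ := monotone_stabilizes_iff_noetherian.2 hnoeth
    ⟨fun i ↦ (S i).comap (I.stableFiltration G).submodule.subtype,
      fun i j hij f hf n ↦ c.monotone hij n (hf n)⟩
  refine ⟨k, fun j hj ↦ le_antisymm (fun n v hv ↦ ?_) (c.monotone hj)⟩
  have hS : PolynomialModule.single R n v ∈ S j := fun m ↦ by
    rw [PolynomialModule.coeff_single, Finsupp.single_apply]
    split_ifs with h
    · exact h ▸ hv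
    · exact zero_mem _
  have h : (S k).comap (I.stableFiltration G).submodule.subtype =
      (S j).comap (I.stableFiltration G).submodule.subtype := hk j hj
  have h' : (⟨_, hle j hS⟩ : (I.stableFiltration G).submodule) ∈
      (S k).comap (I.stableFiltration G).submodule.subtype := by
    exact h ▸ (show (⟨_, hle j hS⟩ : (I.stableFiltration G).submodule) ∈
      (S j).comap (I.stableFiltration G).submodule.subtype from hS)
  simpa using h' n

theorem eventuallyPolynomial_relLength_pow_smul {G H : Submodule R V} (hHG : H ≤ G)
    (hfin : ∃ N₀, ∀ n ≥ N₀, relLength (I ^ n • H) (I ^ n • G) ≠ ⊤) :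
    EventuallyPolynomial fun n ↦ relLength (I ^ n • H) (I ^ n • G) := by
  obtain ⟨s, hs⟩ := (IsNoetherian.noetherian I : I.FG)
  exact eventuallyPolynomial_relLength_of_gradedNoetherian s _ _
    (fun n ↦ smul_mono_right _ hHG) (gradedStable_pow_smul hs H) (gradedStable_pow_smul hs G)
    ((gradedNoetherian_pow_smul I hs G).mono bot_le le_rfl fun _ _ _ h ↦ h) hfin

theorem eventuallyPolynomial_relLength_pow_smul_of_le {J E : Submodule R V} (hJE : J ≤ E)
    (hfin : ∃ N₀, ∀ n ≥ N₀, relLength (I ^ n • J) E ≠ ⊤) :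
    EventuallyPolynomial fun n ↦ relLength (I ^ n • J) E := by
  obtain ⟨N₀, hN₀⟩ := hfin
  have hle (n : ℕ) : I ^ (n + 1) • J ≤ I ^ n • J := smul_mono_left (Ideal.pow_le_pow_right n.le_succ)
  have hadd (n : ℕ) := relLength_add (hle n) (smul_le_right.trans hJE : I ^ n • J ≤ E)
  have hpow (n : ℕ) : I ^ n • I • J = I ^ (n + 1) • J := by rw [← mul_smul, pow_succ]
  have h := eventuallyPolynomial_relLength_pow_smul I (smul_le_right : I • J ≤ J)
    ⟨N₀, fun n hn htop ↦ hN₀ (n + 1) (by lia) (by rw [hadd, ← hpow, htop, top_add])⟩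
  refine .of_add_eq_add (.zero_of_ge (f := fun _ ↦ 0) (N₀ := 0) fun _ _ ↦ rfl) h hN₀ fun n _ ↦ ?_
  rw [hadd, hpow, add_zero, add_comm]

lemma exists_pow_smul_inf_eq (G E : Submodule R V) :
    ∃ k, ∀ n ≥ k, I ^ n • G ⊓ E = I ^ (n - k) • (I ^ k • G ⊓ E) :=
  ((I.stableFiltration_stable G).inter_right (I.trivialFiltration E)).exists_pow_smul_eq_of_ge

theorem eventuallyPolynomial_relLength_sup_pow_smul {E G H : Submodule R V} (hHG : H ≤ G)
    (hfin : ∃ N₀, ∀ n ≥ N₀, relLength (I ^ n • H) (E ⊔ I ^ n • G) ≠ ⊤) :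
    EventuallyPolynomial fun n ↦ relLength (I ^ n • H) (E ⊔ I ^ n • G) := by
  obtain ⟨N₀, hN₀⟩ := hfin
  obtain ⟨k, hk⟩ := exists_pow_smul_inf_eq I G E
  have hadd (n : ℕ) : relLength (I ^ n • H) (E ⊔ I ^ n • G) =
      relLength (I ^ n • H) (I ^ n • G) + relLength (I ^ n • G) E := by
    rw [relLength_add (smul_mono_right _ hHG) le_sup_right, relLength_sup_right]
  have hE : ∀ n ≥ k, relLength (I ^ n • G) E = relLength (I ^ (n - k) • (I ^ k • G ⊓ E)) E :=
    fun n hn ↦ by rw [← hk n hn, relLength_inf_left]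
  simp only [hadd] at hN₀ ⊢
  refine .add (eventuallyPolynomial_relLength_pow_smul I hHG ⟨N₀, fun n hn h ↦ hN₀ n hn ?_⟩)
    (.of_eq_sub (eventuallyPolynomial_relLength_pow_smul_of_le I
      (inf_le_right : I ^ k • G ⊓ E ≤ E) ⟨N₀, fun n hn h ↦ hN₀ (n + k) (by lia) ?_⟩) k hE)
  · rw [h, top_add]
  · rw [hE _ (by lia), Nat.add_sub_cancel, h, add_top]

theorem eventuallyPolynomial_relLength_sup_sup {B E G H : Submodule R V} (hHG : H ≤ G)
    (hfin : ∃ N₀, ∀ n ≥ N₀, relLength (B ⊔ I ^ n • H) (E ⊔ I ^ n • G) ≠ ⊤) :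
    EventuallyPolynomial fun n ↦ relLength (B ⊔ I ^ n • H) (E ⊔ I ^ n • G) := by
  have h (n : ℕ) : relLength (B ⊔ I ^ n • H) (E ⊔ I ^ n • G) =
      relLength (I ^ n • H.map B.mkQ) (E.map B.mkQ ⊔ I ^ n • G.map B.mkQ) := by
    rw [← map_smul'', ← map_smul'', ← Submodule.map_sup, ← relLength_comap, comap_map_mkQ]
  simp only [h] at hfin ⊢
  exact eventuallyPolynomial_relLength_sup_pow_smul I (map_mono hHG) hfin

end Rees

section ArtinRees

variable {R V V' : Type*} [CommRing R] [AddCommGroup V] [Module R V] [AddCommGroup V'] [Module R V']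

lemma mem_smul_top_prod (J : Ideal R) (W : Submodule R V') (x : V × V') :
    x ∈ J • ((⊤ : Submodule R V).prod W) ↔ x.1 ∈ J • (⊤ : Submodule R V) ∧ x.2 ∈ J • W := by
  constructor
  · intro hx
    have h1 := mem_map_of_mem (f := LinearMap.fst R V V') hx
    have h2 := mem_map_of_mem (f := LinearMap.snd R V V') hx
    rw [map_smul''] at h1 h2
    have hW : ((⊤ : Submodule R V).prod W).map (LinearMap.snd R V V') ≤ W :=
      map_le_iff_le_comap.2 fun y hy ↦ hy.2
    exact ⟨smul_mono le_rfl le_top h1, smul_mono le_rfl hW h2⟩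
  · rintro ⟨h1, h2⟩
    have h1' := mem_map_of_mem (f := LinearMap.inl R V V') h1
    have h2' := mem_map_of_mem (f := LinearMap.inr R V V') h2
    rw [map_smul''] at h1' h2'
    have h : x = LinearMap.inl R V V' x.1 + LinearMap.inr R V V' x.2 := by simp
    rw [h]
    have hV : (⊤ : Submodule R V).map (LinearMap.inl R V V') ≤ (⊤ : Submodule R V).prod W :=
      map_le_iff_le_comap.2 fun v _ ↦ ⟨trivial, W.zero_mem⟩
    have hW : W.map (LinearMap.inr R V V') ≤ (⊤ : Submodule R V).prod W :=
      map_le_iff_le_comap.2 fun v hv ↦ ⟨trivial, hv⟩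
    exact add_mem (smul_mono le_rfl hV h1') (smul_mono le_rfl hW h2')

/-- An Artin–Rees statement: the submodules `(U + IⁿV) ∩ φ⁻¹(IⁿW)` have eventually the form
`E + Iⁿ⁻ᵏ G`. -/
theorem exists_sup_pow_smul_inf_comap_eq [IsNoetherianRing R] [Module.Finite R V]
    [Module.Finite R V'] (I : Ideal R) (φ : V →ₗ[R] V') (U : Submodule R V)
    (W : Submodule R V') :
    ∃ k, ∀ n ≥ k, (U ⊔ I ^ n • ⊤) ⊓ (I ^ n • W).comap φ =
      (U ⊓ LinearMap.ker φ) ⊔ I ^ (n - k) • ((U ⊔ I ^ k • ⊤) ⊓ (I ^ k • W).comap φ) := by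
  let Λ : Submodule R (V × V') :=
    (U.prod ⊤ ⊓ LinearMap.ker
      (φ.coprod (φ.coprod (-LinearMap.id) : V × V' →ₗ[R] V'))).map (LinearMap.snd R V (V × V'))
  have hΛ (x : V × V') : x ∈ Λ ↔ ∃ u ∈ U, φ (u + x.1) = x.2 := by
    constructor
    · rintro ⟨⟨u, y⟩, ⟨⟨hu, -⟩, h⟩, rfl⟩
      refine ⟨u, hu, ?_⟩
      change φ u + (φ y.1 + -y.2) = 0 at h
      rw [map_add, ← sub_eq_zero, ← h, LinearMap.snd_apply]
      abel
    · rintro ⟨u, hu, h⟩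
      refine ⟨⟨u, x⟩, ⟨⟨hu, trivial⟩, ?_⟩, rfl⟩
      change φ u + (φ x.1 + -x.2) = 0
      rw [← h, map_add]
      abel
  obtain ⟨k, hk⟩ := exists_pow_smul_inf_eq I ((⊤ : Submodule R V).prod W) Λ
  refine ⟨k, fun n hn ↦ le_antisymm ?_ ?_⟩
  · rintro z ⟨hz, hφz⟩
    obtain ⟨u, hu, v, hv, rfl⟩ := mem_sup.1 hz
    have hmem : (v, φ (u + v)) ∈ I ^ n • ((⊤ : Submodule R V).prod W) ⊓ Λ :=
      ⟨(mem_smul_top_prod _ _ _).2 ⟨hv, hφz⟩, (hΛ _).2 ⟨u, hu, rfl⟩⟩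
    rw [hk n hn] at hmem
    have key : ∀ x ∈ I ^ (n - k) • (I ^ k • ((⊤ : Submodule R V).prod W) ⊓ Λ),
        ∃ u ∈ U, φ (u + x.1) = x.2 ∧
          u + x.1 ∈ I ^ (n - k) • ((U ⊔ I ^ k • ⊤) ⊓ (I ^ k • W).comap φ) := by
      intro x hx
      induction hx using smul_induction_on' with
      | smul r hr y hy =>
        obtain ⟨u, hu, h⟩ := (hΛ y).1 hy.2
        obtain ⟨h1, h2⟩ := (mem_smul_top_prod _ _ _).1 hy.1
        refine ⟨r • u, U.smul_mem r hu, ?_, ?_⟩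
        · rw [Prod.smul_fst, Prod.smul_snd, ← smul_add, map_smul, h]
        · rw [Prod.smul_fst, ← smul_add]
          refine smul_mem_smul hr ⟨add_mem_sup hu h1, ?_⟩
          rw [← h] at h2
          exact h2
      | add x _ y _ hx hy =>
        obtain ⟨u, hu, h, h'⟩ := hx
        obtain ⟨w, hw, e, e'⟩ := hy
        have hsum : u + w + (x + y).1 = (u + x.1) + (w + y.1) := by
          rw [Prod.fst_add]; abel
        refine ⟨u + w, add_mem hu hw, ?_, ?_⟩
        · rw [hsum, map_add, h, e, Prod.snd_add]
        · rw [hsum]; exact add_mem h' e'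
    obtain ⟨w, hw, h1, h2⟩ := key _ hmem
    dsimp only at h1 h2
    have hsum : u + v = (u - w) + (w + v) := by abel
    rw [hsum]
    refine add_mem_sup ⟨sub_mem hu hw, ?_⟩ h2
    rw [map_add, map_add, add_left_inj] at h1
    rw [SetLike.mem_coe, LinearMap.mem_ker, map_sub, h1, sub_self]
  · have hpow : I ^ n = I ^ (n - k) * I ^ k := by rw [← pow_add, Nat.sub_add_cancel hn]
    refine sup_le (le_inf (inf_le_left.trans le_sup_left) fun x hx ↦ ?_) (le_inf ?_ ?_)
    · rw [mem_comap, LinearMap.mem_ker.1 hx.2]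
      exact zero_mem _
    · refine (smul_mono_right _ inf_le_left).trans ?_
      rw [smul_sup, hpow, mul_smul]
      exact sup_le_sup_right smul_le_right _
    · rw [← map_le_iff_le_comap, map_smul'', hpow, mul_smul]
      exact smul_mono_right _ (map_le_iff_le_comap.2 inf_le_right)

end ArtinRees

section Tensor

open TensorProduct

variable {R : Type*} [CommRing R] {F F' A V : Type*} [AddCommGroup F] [Module R F]
  [AddCommGroup F'] [Module R F'] [AddCommGroup A] [Module R A] [AddCommGroup V] [Module R V]

variable (F) in
/-- The image of `F ⊗ N` in `F ⊗ V` for a submodule `N` of `V`. -/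
def tensorImage (N : Submodule R V) : Submodule R (F ⊗[R] V) :=
  map₂ (TensorProduct.mk R F V) ⊤ N

lemma map_lTensor_tensorImage (g : A →ₗ[R] V) (N : Submodule R A) :
    (tensorImage F N).map (g.lTensor F) = tensorImage F (N.map g) := by
  simp only [tensorImage, map₂_eq_span_image2, map_span, Set.image_image2, map_coe,
    Set.image2_image_right]
  rfl

lemma map_rTensor_tensorImage_le (f : F →ₗ[R] F') (N : Submodule R V) :
    (tensorImage F N).map (f.rTensor V) ≤ tensorImage F' N := by
  rw [map_le_iff_le_comap]
  exact map₂_le.2 fun x _ v hv ↦ apply_mem_map₂ _ mem_top hv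

lemma tensorImage_top : tensorImage F (⊤ : Submodule R V) = ⊤ :=
  map₂_mk_top_top_eq_top R F V

lemma range_lTensor_eq (g : A →ₗ[R] V) :
    LinearMap.range (g.lTensor F) = tensorImage F (LinearMap.range g) := by
  rw [LinearMap.range_eq_map, LinearMap.range_eq_map, ← tensorImage_top, map_lTensor_tensorImage]

lemma range_lTensor_subtype_map (g : A →ₗ[R] V) (N : Submodule R A) :
    LinearMap.range ((N.map g).subtype.lTensor F) = (tensorImage F N).map (g.lTensor F) := by
  rw [range_lTensor_eq, range_subtype, map_lTensor_tensorImage]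

lemma tensorImage_sup (N N' : Submodule R V) :
    tensorImage F (N ⊔ N') = tensorImage F N ⊔ tensorImage F N' :=
  map₂_sup_right _ _ _ _

lemma tensorImage_smul (J : Ideal R) (N : Submodule R V) :
    tensorImage F (J • N) = J • tensorImage F N := by
  apply le_antisymm
  · refine map₂_le.2 fun x _ v hv ↦ ?_
    have h := mem_map_of_mem (f := TensorProduct.mk R F V x) hv
    rw [map_smul''] at h
    exact smul_mono_right J (map_le_iff_le_comap.2 fun w hw ↦ apply_mem_map₂ _ mem_top hw) h
  · refine smul_le.2 fun r hr x hx ↦ ?_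
    have h : tensorImage F N ≤
        (tensorImage F (J • N)).comap (LinearMap.lsmul R (F ⊗[R] V) r) :=
      map₂_le.2 fun x _ v hv ↦ by
        rw [mem_comap, LinearMap.lsmul_apply, TensorProduct.mk_apply, ← tmul_smul]
        exact apply_mem_map₂ _ mem_top (smul_mem_smul hr hv)
    exact h hx

lemma ker_lTensor_mkQ (D : Submodule R V) :
    LinearMap.ker (D.mkQ.lTensor F) = tensorImage F D := by
  rw [LinearMap.exact_iff.1 (lTensor_exact F (LinearMap.exact_subtype_mkQ D) D.mkQ_surjective),
    range_lTensor_eq, range_subtype]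

/-- For flat `F₀` and `F₁`, the homology of a complex tensored with `(N + D) / D`, computed inside
`F₁ ⊗ V`. -/
theorem relLength_rTensor_map_mkQ {F₀ F₁ F₂ : Type*} [AddCommGroup F₀] [Module R F₀]
    [AddCommGroup F₁] [Module R F₁] [AddCommGroup F₂] [Module R F₂] [Module.Flat R F₀]
    [Module.Flat R F₁] (ψ : F₂ →ₗ[R] F₁) (φ : F₁ →ₗ[R] F₀) (N D : Submodule R V) :
    relLength (LinearMap.range (ψ.rTensor (N.map D.mkQ)))
        (LinearMap.ker (φ.rTensor (N.map D.mkQ))) =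
      relLength ((tensorImage F₂ N).map (ψ.rTensor V) ⊔ tensorImage F₁ D)
        (tensorImage F₁ N ⊓ (tensorImage F₀ D).comap (φ.rTensor V)) := by
  set L := N.map D.mkQ
  have hj₁ : Function.Injective (L.subtype.lTensor F₁) :=
    Module.Flat.lTensor_preserves_injective_linearMap _ L.subtype_injective
  have hj₀ : Function.Injective (L.subtype.lTensor F₀) :=
    Module.Flat.lTensor_preserves_injective_linearMap _ L.subtype_injective
  have hB : (LinearMap.range (ψ.rTensor L)).map (L.subtype.lTensor F₁) =
      ((tensorImage F₂ N).map (ψ.rTensor V)).map (D.mkQ.lTensor F₁) := by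
    rw [← LinearMap.range_comp, LinearMap.lTensor_comp_rTensor, ← LinearMap.rTensor_comp_lTensor,
      LinearMap.range_comp, range_lTensor_subtype_map, ← Submodule.map_comp, ← Submodule.map_comp, LinearMap.lTensor_comp_rTensor,
      LinearMap.rTensor_comp_lTensor]
  have hker : (LinearMap.ker (φ.rTensor (V ⧸ D))).comap (D.mkQ.lTensor F₁) =
      (tensorImage F₀ D).comap (φ.rTensor V) := by
    rw [← LinearMap.ker_comp, LinearMap.rTensor_comp_lTensor, ← LinearMap.lTensor_comp_rTensor,
      LinearMap.ker_comp, ker_lTensor_mkQ]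
  have hZ : (LinearMap.ker (φ.rTensor L)).map (L.subtype.lTensor F₁) =
      (tensorImage F₁ N ⊓ (tensorImage F₀ D).comap (φ.rTensor V)).map (D.mkQ.lTensor F₁) := by
    have h : LinearMap.ker (φ.rTensor L) =
        (LinearMap.ker (φ.rTensor (V ⧸ D))).comap (L.subtype.lTensor F₁) := by
      rw [← LinearMap.ker_comp, LinearMap.rTensor_comp_lTensor,
        ← LinearMap.lTensor_comp_rTensor, LinearMap.ker_comp, LinearMap.ker_eq_bot.2 hj₀,
        comap_bot]
    rw [h, map_comap_eq, range_lTensor_subtype_map, ← hker, map_inf_eq_map_inf_comap]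
  rw [← comap_map_eq_of_injective hj₁ (LinearMap.range (ψ.rTensor L)), relLength_comap, hB, hZ,
    ← relLength_comap, comap_map_eq, ker_lTensor_mkQ]

end Tensor

section Main

variable {R : Type*} [CommRing R] [IsNoetherianRing R] (I : Ideal R) {V : Type*} [AddCommGroup V]
  [Module R V] [Module.Finite R V] (U W : Submodule R V) {F₀ F₁ F₂ : Type*} [AddCommGroup F₀]
  [Module R F₀] [AddCommGroup F₁] [Module R F₁] [AddCommGroup F₂] [Module R F₂]
  [Module.Finite R F₀] [Module.Finite R F₁]

theorem eventuallyPolynomial_relLength_tensorImage (ψ : F₂ →ₗ[R] F₁) (φ : F₁ →ₗ[R] F₀)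
    (hc : φ ∘ₗ ψ = 0)
    (hfin : ∃ N₀ : ℕ, ∀ n ≥ N₀,
      relLength ((tensorImage F₂ (U ⊔ I ^ n • ⊤)).map (ψ.rTensor V) ⊔ tensorImage F₁ (I ^ n • W))
        (tensorImage F₁ (U ⊔ I ^ n • ⊤) ⊓ (tensorImage F₀ (I ^ n • W)).comap (φ.rTensor V)) ≠ ⊤) :
    EventuallyPolynomial fun n ↦
      relLength ((tensorImage F₂ (U ⊔ I ^ n • ⊤)).map (ψ.rTensor V) ⊔ tensorImage F₁ (I ^ n • W))
        (tensorImage F₁ (U ⊔ I ^ n • ⊤) ⊓ (tensorImage F₀ (I ^ n • W)).comap (φ.rTensor V)) := by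
  obtain ⟨k, hk⟩ := exists_sup_pow_smul_inf_comap_eq I (φ.rTensor V) (tensorImage F₁ U)
    (tensorImage F₀ W)
  set B := (tensorImage F₂ U).map (ψ.rTensor V)
  set E := tensorImage F₁ U ⊓ LinearMap.ker (φ.rTensor V)
  set G := (tensorImage F₁ U ⊔ I ^ k • ⊤) ⊓ (I ^ k • tensorImage F₀ W).comap (φ.rTensor V)
  set H := I ^ k • (LinearMap.range (ψ.rTensor V) ⊔ tensorImage F₁ W) with hH
  have hHG : H ≤ G := by
    refine le_inf ((smul_mono_right _ le_top).trans le_sup_right) ?_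
    rw [← map_le_iff_le_comap, map_smul'']
    refine smul_mono_right _ ?_
    rw [Submodule.map_sup, ← LinearMap.range_comp, ← LinearMap.rTensor_comp, hc,
      LinearMap.rTensor_zero, LinearMap.range_zero, bot_sup_eq]
    exact map_rTensor_tensorImage_le φ W
  have heq : ∀ n ≥ k,
      relLength ((tensorImage F₂ (U ⊔ I ^ n • ⊤)).map (ψ.rTensor V) ⊔ tensorImage F₁ (I ^ n • W))
        (tensorImage F₁ (U ⊔ I ^ n • ⊤) ⊓ (tensorImage F₀ (I ^ n • W)).comap (φ.rTensor V)) =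
      relLength (B ⊔ I ^ (n - k) • H) (E ⊔ I ^ (n - k) • G) := fun n hn ↦ by
    rw [← hk n hn, hH, ← mul_smul, ← pow_add, Nat.sub_add_cancel hn]
    simp only [tensorImage_sup, tensorImage_smul, tensorImage_top, Submodule.map_sup, map_smul'',
      smul_sup, B, LinearMap.range_eq_map, sup_assoc]
  obtain ⟨N₀, hN₀⟩ := hfin
  refine (eventuallyPolynomial_relLength_sup_sup I (B := B) (E := E) hHG
    ⟨N₀, fun n hn ↦ ?_⟩).of_eq_sub k heq
  have h := hN₀ (n + k) (by lia)
  rwa [heq _ (by lia), Nat.add_sub_cancel] at h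

end Main

/-- Proposition 3(b). Let `R` be a commutative Noetherian ring, `I` an ideal,
and `C : F₂ →ψ F₁ →φ F₀` a complex of finitely generated flat `R`-modules.  Let `U`, `W` be
submodules of a finitely generated `R`-module `V`.  If `H₁(C ⊗ (U + IⁿV)/IⁿW)` has finite
length for all `n ≫ 0` (where `(U + IⁿV)/IⁿW` is realized as the image of `U + IⁿV` in
`V/IⁿW`), then there is a polynomial `p ∈ ℚ[X]` with
`λ(H₁(C ⊗ (U + IⁿV)/IⁿW)) = p(n)` for all `n ≫ 0`. -/
theorem stmt_6 {R : Type*} [CommRing R] [IsNoetherianRing R] (I : Ideal R)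
    {V : Type*} [AddCommGroup V] [Module R V] [Module.Finite R V]
    (U W : Submodule R V)
    {F₀ F₁ F₂ : Type*}
    [AddCommGroup F₀] [Module R F₀] [AddCommGroup F₁] [Module R F₁]
    [AddCommGroup F₂] [Module R F₂]
    [Module.Finite R F₀] [Module.Finite R F₁] [Module.Finite R F₂]
    [Module.Flat R F₀] [Module.Flat R F₁] [Module.Flat R F₂]
    (ψ : F₂ →ₗ[R] F₁) (φ : F₁ →ₗ[R] F₀) (hc : φ ∘ₗ ψ = 0)
    (hfin : ∃ N₀ : ℕ, ∀ n ≥ N₀,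
      IsFiniteLength R (homologyOne ψ φ
        ↥((U ⊔ I ^ n • (⊤ : Submodule R V)).map (I ^ n • W).mkQ))) :
    ∃ (p : Polynomial ℚ) (N₀ : ℕ), ∀ n ≥ N₀, ∃ ℓ : ℕ,
      moduleLength R (homologyOne ψ φ
        ↥((U ⊔ I ^ n • (⊤ : Submodule R V)).map (I ^ n • W).mkQ)) = ℓ ∧
      (ℓ : ℚ) = p.eval (n : ℚ) := by
  have hlen (n : ℕ) := relLength_rTensor_map_mkQ ψ φ (U ⊔ I ^ n • (⊤ : Submodule R V)) (I ^ n • W)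
  obtain ⟨N₀, hN₀⟩ := hfin
  obtain ⟨p, N₁, h⟩ := eventuallyPolynomial_relLength_tensorImage I U W ψ φ hc
    ⟨N₀, fun n hn ↦ hlen n ▸ Module.length_ne_top_iff.2 (hN₀ n hn)⟩
  refine ⟨p, N₁, fun n hn ↦ ?_⟩
  obtain ⟨ℓ, h1, h2⟩ := h n hn
  exact ⟨ℓ, (Module.coe_length R _).symm.trans (congrArg _ ((hlen n).trans h1)), h2⟩
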